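/- arXiv:1911.02643 — 3 statements merged into one kernel-verified Lean document; each statement's English description precedes it below -/
import Mathlib

section
/- Let a, b ∈ ℝ, c ≥ 0, let μ be a nonnegative measure on (0,∞), and let h : (0,∞) → (0,∞) be measurable such that for every x > 0 the integral ∫₀^∞ log((t+x)/h(t)) dμ(t) is finite, and define f(x) := a + b·x + c·log x + ∫₀^∞ log((t+x)/h(t)) dμ(t) for x > 0. Then for all X, Y ∈ ℙ_d, the quantum Jensen divergence Δ_f(X,Y) := tr f((X+Y)/2) − (1/2)·tr f(X) − (1/2)·tr f(Y) satisfies Δ_f(X,Y) = c·δ_S²(X,Y) + ∫₀^∞ δ_S²(tI+X, tI+Y) dμ(t), where I is the d×d identity matrix. -/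
open MeasureTheory Matrix
open scoped ComplexOrder

/-- `tr g(X)` for a Hermitian matrix `X`: the sum of `g` over the eigenvalues of `X`. -/
noncomputable def traceF {d : ℕ} (g : ℝ → ℝ) (X : Matrix (Fin d) (Fin d) ℂ) : ℝ :=
  if hX : X.IsHermitian then ∑ i, g (hX.eigenvalues i) else 0

/-- The quantum Jensen divergence `Δ_f(X,Y) = tr f((X+Y)/2) − (1/2) tr f(X) − (1/2) tr f(Y)`. -/
noncomputable def jensenDiv {d : ℕ} (f : ℝ → ℝ) (X Y : Matrix (Fin d) (Fin d) ℂ) : ℝ :=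
  traceF f ((1 / 2 : ℝ) • (X + Y)) - (1 / 2) * traceF f X - (1 / 2) * traceF f Y

/-- The S-divergence `δ_S²(X,Y) = log det((X+Y)/2) − (1/2) log det X − (1/2) log det Y`. -/
noncomputable def deltaS2 {d : ℕ} (X Y : Matrix (Fin d) (Fin d) ℂ) : ℝ :=
  Real.log (((1 / 2 : ℝ) • (X + Y)).det.re)
    - (1 / 2) * Real.log (X.det.re) - (1 / 2) * Real.log (Y.det.re)

theorem Matrix.IsHermitian.det_smul_one_add_re {d : ℕ} {Z : Matrix (Fin d) (Fin d) ℂ}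
    (hZ : Z.IsHermitian) (t : ℝ) :
    (t • (1 : Matrix (Fin d) (Fin d) ℂ) + Z).det.re = ∏ i, (t + hZ.eigenvalues i) := by
  have h₁ : t • (1 : Matrix (Fin d) (Fin d) ℂ) + Z = -(scalar (Fin d) (-(t : ℂ)) - Z) := by
    ext i j
    by_cases hij : i = j <;> simp [hij, add_comm]
  have h₂ : (t • (1 : Matrix (Fin d) (Fin d) ℂ) + Z).det
      = ((∏ i, (t + hZ.eigenvalues i) : ℝ) : ℂ) := by
    rw [h₁, det_neg, ← eval_charpoly, hZ.charpoly_eq, Polynomial.eval_prod,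
      ← Finset.card_univ, ← Finset.prod_const, ← Finset.prod_mul_distrib]
    push_cast
    refine Finset.prod_congr rfl fun i _ => ?_
    simp
    ring
  rw [h₂, Complex.ofReal_re]

theorem Matrix.PosDef.log_det_smul_one_add_re {d : ℕ} {Z : Matrix (Fin d) (Fin d) ℂ}
    (hZ : Z.PosDef) {t : ℝ} (ht : 0 ≤ t) :
    Real.log (t • (1 : Matrix (Fin d) (Fin d) ℂ) + Z).det.re
      = ∑ i, Real.log (t + hZ.1.eigenvalues i) := by
  rw [hZ.1.det_smul_one_add_re, Real.log_prod fun i _ => ?_]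
  exact (add_pos_of_nonneg_of_pos ht (hZ.eigenvalues_pos i)).ne'

theorem Matrix.PosDef.log_det_re {d : ℕ} {Z : Matrix (Fin d) (Fin d) ℂ} (hZ : Z.PosDef) :
    Real.log Z.det.re = ∑ i, Real.log (hZ.1.eigenvalues i) := by
  simpa using hZ.log_det_smul_one_add_re le_rfl

theorem Matrix.IsHermitian.sum_eigenvalues {d : ℕ} {Z : Matrix (Fin d) (Fin d) ℂ}
    (hZ : Z.IsHermitian) : ∑ i, hZ.eigenvalues i = Z.trace.re := by
  simp [hZ.trace_eq_sum_eigenvalues]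

theorem integral_sub_half_sub_half {α : Type*} [MeasurableSpace α] {μ : Measure α} {u v w : α → ℝ}
    (hu : Integrable u μ) (hv : Integrable v μ) (hw : Integrable w μ) :
    ∫ t, (u t - (1 / 2) * v t - (1 / 2) * w t) ∂μ
      = (∫ t, u t ∂μ) - (1 / 2) * (∫ t, v t ∂μ) - (1 / 2) * ∫ t, w t ∂μ := by
  have hv' := hv.const_mul (1 / 2)
  have huv : Integrable (fun t => u t - (1 / 2) * v t) μ := hu.sub hv'
  rw [integral_sub huv (hw.const_mul _), integral_sub hu hv', integral_const_mul,
    integral_const_mul]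

theorem integrableOn_sum_log_eigenvalues {d : ℕ} {μ : Measure ℝ} {h : ℝ → ℝ}
    (hint : ∀ x > (0:ℝ), IntegrableOn (fun t => Real.log ((t + x) / h t)) (Set.Ioi 0) μ)
    {Z : Matrix (Fin d) (Fin d) ℂ} (hZ : Z.PosDef) :
    IntegrableOn (fun t => ∑ i, Real.log ((t + hZ.1.eigenvalues i) / h t)) (Set.Ioi 0) μ :=
  integrable_finsetSum _ fun i _ => hint _ (hZ.eigenvalues_pos i)

theorem sum_log_eigenvalues_div {d : ℕ} {Z : Matrix (Fin d) (Fin d) ℂ} (hZ : Z.PosDef)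
    {t s : ℝ} (ht : 0 < t) (hs : 0 < s) :
    ∑ i, Real.log ((t + hZ.1.eigenvalues i) / s)
      = Real.log (t • (1 : Matrix (Fin d) (Fin d) ℂ) + Z).det.re - d * Real.log s := by
  rw [hZ.log_det_smul_one_add_re ht.le, Finset.sum_congr rfl fun i _ =>
    Real.log_div (add_pos ht (hZ.eigenvalues_pos i)).ne' hs.ne']
  simp

theorem traceF_eq_integral {d : ℕ} {a b c : ℝ} {μ : Measure ℝ} {h f : ℝ → ℝ}
    (hint : ∀ x > (0:ℝ), IntegrableOn (fun t => Real.log ((t + x) / h t)) (Set.Ioi 0) μ)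
    (hf : ∀ x > (0:ℝ), f x = a + b * x + c * Real.log x
        + ∫ t in Set.Ioi (0:ℝ), Real.log ((t + x) / h t) ∂μ)
    {Z : Matrix (Fin d) (Fin d) ℂ} (hZ : Z.PosDef) :
    traceF f Z = d * a + b * Z.trace.re + c * Real.log Z.det.re
      + ∫ t in Set.Ioi (0:ℝ), ∑ i, Real.log ((t + hZ.1.eigenvalues i) / h t) ∂μ := by
  rw [traceF, dif_pos hZ.1, integral_finsetSum _ fun i _ => hint _ (hZ.eigenvalues_pos i),
    hZ.log_det_re, ← hZ.1.sum_eigenvalues,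
    Finset.sum_congr rfl fun i _ => hf _ (hZ.eigenvalues_pos i)]
  simp [Finset.sum_add_distrib, Finset.mul_sum]

/-- If `f(x) = a + b·x + c·log x + ∫₀^∞ log((t+x)/h(t)) dμ(t)` with `c ≥ 0`, then
`Δ_f(X,Y) = c·δ_S²(X,Y) + ∫₀^∞ δ_S²(tI+X, tI+Y) dμ(t)` for all `X, Y ∈ ℙ_d`. -/
theorem jensenDiv_eq_integral_deltaS2 {d : ℕ} (a b c : ℝ) (hc : 0 ≤ c) (μ : Measure ℝ)
    (h : ℝ → ℝ) (hmeas : Measurable fun t : Set.Ioi (0:ℝ) => h t)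
    (hpos : ∀ t ∈ Set.Ioi (0:ℝ), 0 < h t)
    (hint : ∀ x > (0:ℝ),
      IntegrableOn (fun t => Real.log ((t + x) / h t)) (Set.Ioi 0) μ)
    (f : ℝ → ℝ)
    (hf : ∀ x > (0:ℝ), f x = a + b * x + c * Real.log x
        + ∫ t in Set.Ioi (0:ℝ), Real.log ((t + x) / h t) ∂μ)
    (X Y : Matrix (Fin d) (Fin d) ℂ) (hX : X.PosDef) (hY : Y.PosDef) :
    jensenDiv f X Y = c * deltaS2 X Y
      + ∫ t in Set.Ioi (0:ℝ),
          deltaS2 (t • (1 : Matrix (Fin d) (Fin d) ℂ) + X)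
                  (t • (1 : Matrix (Fin d) (Fin d) ℂ) + Y) ∂μ := by
  have hM : ((1 / 2 : ℝ) • (X + Y)).PosDef := (hX.add hY).smul (by norm_num)
  have iX := integrableOn_sum_log_eigenvalues hint hX
  have iY := integrableOn_sum_log_eigenvalues hint hY
  have iM := integrableOn_sum_log_eigenvalues hint hM
  have key : ∫ t in Set.Ioi (0:ℝ),
        deltaS2 (t • (1 : Matrix (Fin d) (Fin d) ℂ) + X)
          (t • (1 : Matrix (Fin d) (Fin d) ℂ) + Y) ∂μ
      = (∫ t in Set.Ioi (0:ℝ), ∑ i, Real.log ((t + hM.1.eigenvalues i) / h t) ∂μ)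
        - (1 / 2) * (∫ t in Set.Ioi (0:ℝ), ∑ i, Real.log ((t + hX.1.eigenvalues i) / h t) ∂μ)
        - (1 / 2) * ∫ t in Set.Ioi (0:ℝ), ∑ i, Real.log ((t + hY.1.eigenvalues i) / h t) ∂μ := by
    rw [← integral_sub_half_sub_half iM iX iY]
    refine setIntegral_congr_fun measurableSet_Ioi fun t ht => ?_
    have hmid : (1 / 2 : ℝ) • (t • (1 : Matrix (Fin d) (Fin d) ℂ) + X
        + (t • (1 : Matrix (Fin d) (Fin d) ℂ) + Y))
        = t • (1 : Matrix (Fin d) (Fin d) ℂ) + (1 / 2 : ℝ) • (X + Y) := by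
      module
    simp only [deltaS2, hmid, sum_log_eigenvalues_div hM ht (hpos t ht),
      sum_log_eigenvalues_div hX ht (hpos t ht), sum_log_eigenvalues_div hY ht (hpos t ht)]
    ring
  have htr : ((1 / 2 : ℝ) • (X + Y)).trace.re = (1 / 2) * (X.trace.re + Y.trace.re) := by
    simp [trace_smul, trace_add, mul_add]
  rw [key, jensenDiv, traceF_eq_integral hint hf hM, traceF_eq_integral hint hf hX,
    traceF_eq_integral hint hf hY, htr, deltaS2]
  ring
end

section
/- For every α ∈ (1,2), the function √(QJSD_α) is a metric on ℙ_d: QJSD_α(X,Y) ≥ 0 with equality iff X = Y, QJSD_α(X,Y) = QJSD_α(Y,X), and √(QJSD_α(X,Z)) ≤ √(QJSD_α(X,Y)) + √(QJSD_α(Y,Z)) for all X, Y, Z ∈ ℙ_d. -/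
open Matrix
open scoped ComplexOrder

/-- The α-Tsallis entropy `S_α(X) = (tr(X^α) − tr X)/(1−α)`. -/
noncomputable def tsallisEntropy {d : ℕ} (α : ℝ) (X : Matrix (Fin d) (Fin d) ℂ) : ℝ :=
  (traceF (fun x => x ^ α) X - traceF (fun x => x) X) / (1 - α)

/-- The quantum Jensen-Shannon-Tsallis divergence
`QJSD_α(X,Y) = S_α((X+Y)/2) − (1/2)(S_α(X)+S_α(Y))`. -/
noncomputable def qjsdα {d : ℕ} (α : ℝ) (X Y : Matrix (Fin d) (Fin d) ℂ) : ℝ :=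
  tsallisEntropy α ((1 / 2 : ℝ) • (X + Y))
    - (1 / 2) * (tsallisEntropy α X + tsallisEntropy α Y)

section

open MeasureTheory Set

/-- The kernel representing `a ^ α` for `1 < α < 2`. -/
noncomputable def powKernel (α a s : ℝ) : ℝ := s ^ (-(α + 1)) * (a * s - Real.log (1 + a * s))

theorem sub_log_one_add_nonneg {u : ℝ} (hu : 0 ≤ u) : 0 ≤ u - Real.log (1 + u) := by
  have := Real.log_le_sub_one_of_pos (show 0 < 1 + u by linarith)
  linarith

theorem sub_log_one_add_le_sq {u : ℝ} (hu : 0 ≤ u) : u - Real.log (1 + u) ≤ u ^ 2 := by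
  have h1 : 0 < 1 + u := by linarith
  have := Real.one_sub_inv_le_log_of_pos h1
  have h2 : u - (1 - (1 + u)⁻¹) ≤ u ^ 2 := by
    have : u - (1 - (1 + u)⁻¹) = u ^ 2 / (1 + u) := by field_simp; ring
    rw [this, div_le_iff₀ h1]
    nlinarith [pow_nonneg hu 3]
  linarith

theorem powKernel_nonneg {α a s : ℝ} (ha : 0 ≤ a) (hs : 0 < s) : 0 ≤ powKernel α a s :=
  mul_nonneg (Real.rpow_nonneg hs.le _) (sub_log_one_add_nonneg (by positivity))

theorem integrableOn_powKernel {α a : ℝ} (hα : α ∈ Ioo (1 : ℝ) 2) (ha : 0 ≤ a) :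
    IntegrableOn (powKernel α a) (Ioi 0) := by
  have hm : Measurable (powKernel α a) := by unfold powKernel; fun_prop
  rw [← Ioc_union_Ioi_eq_Ioi zero_le_one]
  refine IntegrableOn.union ?_ ?_
  · have hi : IntegrableOn (fun s : ℝ => a ^ 2 * s ^ (1 - α)) (Ioc 0 1) :=
      ((intervalIntegrable_iff_integrableOn_Ioc_of_le zero_le_one).1
        (intervalIntegral.intervalIntegrable_rpow' (by linarith [hα.2]))).const_mul _
    refine Integrable.mono' hi hm.aestronglyMeasurable
      (ae_restrict_of_forall_mem measurableSet_Ioc fun s hs => ?_)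
    have h0 : 0 < s := hs.1
    rw [Real.norm_of_nonneg (powKernel_nonneg ha h0)]
    calc powKernel α a s ≤ s ^ (-(α + 1)) * (a * s) ^ 2 :=
          mul_le_mul_of_nonneg_left (sub_log_one_add_le_sq (by positivity))
            (Real.rpow_nonneg h0.le _)
      _ = a ^ 2 * s ^ (1 - α) := by
          rw [show 1 - α = -(α + 1) + 2 by ring, Real.rpow_add h0, Real.rpow_two]; ring
  · have hi : IntegrableOn (fun s : ℝ => a * s ^ (-α)) (Ioi 1) :=
      (integrableOn_Ioi_rpow_of_lt (by linarith [hα.1]) zero_lt_one).const_mul _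
    refine Integrable.mono' hi hm.aestronglyMeasurable
      (ae_restrict_of_forall_mem measurableSet_Ioi fun s hs => ?_)
    have h0 : 0 < s := zero_lt_one.trans hs
    rw [Real.norm_of_nonneg (powKernel_nonneg ha h0)]
    calc powKernel α a s ≤ s ^ (-(α + 1)) * (a * s) := by
          refine mul_le_mul_of_nonneg_left ?_ (Real.rpow_nonneg h0.le _)
          linarith [Real.log_nonneg (show 1 ≤ 1 + a * s by nlinarith)]
      _ = a * s ^ (-α) := by
          rw [show -α = -(α + 1) + 1 by ring, Real.rpow_add h0, Real.rpow_one]; ring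

theorem integral_powKernel {α a : ℝ} (ha : 0 < a) :
    ∫ s in Ioi 0, powKernel α a s = a ^ α * ∫ s in Ioi 0, powKernel α 1 s := by
  have h : ∀ s ∈ Ioi (0 : ℝ), powKernel α a s = a ^ (α + 1) * powKernel α 1 (a * s) := by
    intro s hs
    have hs : 0 < s := hs
    simp only [powKernel, one_mul]
    rw [Real.mul_rpow ha.le hs.le, ← mul_assoc, ← mul_assoc, ← Real.rpow_add ha]
    simp
  rw [setIntegral_congr_fun measurableSet_Ioi h, integral_const_mul,
    integral_comp_mul_left_Ioi _ _ ha, mul_zero, Real.rpow_add_one ha.ne', smul_eq_mul]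
  field_simp

theorem exists_eq_zero_of_setIntegral_Ioi_eq_zero {f : ℝ → ℝ} (hi : IntegrableOn f (Ioi 0))
    (h0 : ∀ s, 0 < s → 0 ≤ f s) (h : ∫ s in Ioi 0, f s = 0) : ∃ s, 0 < s ∧ f s = 0 := by
  rw [setIntegral_eq_zero_iff_of_nonneg_ae (ae_restrict_of_forall_mem measurableSet_Ioi h0) hi] at h
  have : (ae (volume.restrict (Ioi (0 : ℝ)))).NeBot := by
    rw [ae_neBot]
    simp
  obtain ⟨s, hs, hs'⟩ := (h.and (ae_restrict_mem measurableSet_Ioi)).exists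
  exact ⟨s, hs', hs⟩

theorem integral_powKernel_one_pos {α : ℝ} (hα : α ∈ Ioo (1 : ℝ) 2) :
    0 < ∫ s in Ioi 0, powKernel α 1 s := by
  have h0 : ∀ s, 0 < s → 0 ≤ powKernel α 1 s := fun s => powKernel_nonneg zero_le_one
  refine lt_of_le_of_ne (setIntegral_nonneg measurableSet_Ioi h0) fun h => ?_
  obtain ⟨s, hs, h⟩ := exists_eq_zero_of_setIntegral_Ioi_eq_zero
    (integrableOn_powKernel hα zero_le_one) h0 h.symm
  have := Real.log_lt_sub_one_of_pos (show 0 < 1 + 1 * s by linarith) (by linarith)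
  exact (mul_pos (Real.rpow_pos_of_pos hs _) (show 0 < 1 * s - Real.log (1 + 1 * s) by
    linarith)).ne' h

theorem Matrix.PosDef.one_add_smul {n : Type*} [DecidableEq n] {X : Matrix n n ℂ}
    (hX : X.PosDef) {s : ℝ} (hs : 0 < s) :
    (1 + s • X).PosDef :=
  PosDef.one.add (hX.smul hs)

section

variable {n : Type*} [Fintype n]

/-- The squared Frobenius norm. -/
noncomputable def frobSq (A : Matrix n n ℂ) : ℝ := (A * Aᴴ).trace.re

theorem frobSq_nonneg (A : Matrix n n ℂ) : 0 ≤ frobSq A :=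
  (Complex.le_def.1 (posSemidef_self_mul_conjTranspose A).trace_nonneg).1

theorem frobSq_smul (c : ℝ) (A : Matrix n n ℂ) : frobSq (c • A) = c ^ 2 * frobSq A := by
  simp [frobSq, conjTranspose_smul, pow_two, mul_assoc]

theorem frobSq_eq_zero {A : Matrix n n ℂ} (h : frobSq A = 0) : A = 0 := by
  rw [← trace_mul_conjTranspose_self_eq_zero_iff]
  have := Complex.le_def.1 (posSemidef_self_mul_conjTranspose A).trace_nonneg
  exact Complex.ext h this.2.symm

variable [DecidableEq n]


/-- The logarithm of the absolute value of the determinant. -/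
noncomputable def logAbsDet (A : Matrix n n ℂ) : ℝ := Real.log ‖A.det‖

/-- The log-determinant (Stein) divergence of two matrices. -/
noncomputable def steinDiv (A B : Matrix n n ℂ) : ℝ :=
  logAbsDet ((1 / 2 : ℝ) • (A + B)) - (1 / 2) * (logAbsDet A + logAbsDet B)

theorem Matrix.PosSemidef.norm_det_le_exp {P : Matrix n n ℂ} (hP : P.PosSemidef) :
    ‖P.det‖ ≤ Real.exp (P.trace.re - Fintype.card n) := by
  rw [hP.isHermitian.det_eq_prod_eigenvalues, hP.isHermitian.trace_eq_sum_eigenvalues, norm_prod]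
  have : (∑ i, (hP.isHermitian.eigenvalues i : ℂ)).re - Fintype.card n
      = ∑ i, (hP.isHermitian.eigenvalues i - 1) := by
    simp [Finset.sum_sub_distrib]
  refine le_trans ?_ (congrArg Real.exp this).ge
  rw [Real.exp_sum]
  refine Finset.prod_le_prod (fun i _ => norm_nonneg _) fun i _ => ?_
  have h0 := hP.eigenvalues_nonneg i
  have := Real.add_one_le_exp (hP.isHermitian.eigenvalues i - 1)
  simp only [sub_add_cancel] at this
  simpa [abs_of_nonneg h0] using this

theorem logAbsDet_mul {A B : Matrix n n ℂ} (hA : A.det ≠ 0) (hB : B.det ≠ 0) :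
    logAbsDet (A * B) = logAbsDet A + logAbsDet B := by
  simp only [logAbsDet, det_mul, norm_mul]
  exact Real.log_mul (norm_ne_zero_iff.2 hA) (norm_ne_zero_iff.2 hB)

theorem logAbsDet_one : logAbsDet (1 : Matrix n n ℂ) = 0 := by simp [logAbsDet]

theorem logAbsDet_one_add_mul_le (T U : Matrix n n ℂ) (h : (1 + T * U).det ≠ 0) :
    logAbsDet (1 + T * U) ≤ (frobSq T + frobSq U) / 2 := by
  have key := (posSemidef_self_mul_conjTranspose
    (fromBlocks 1 U (-T) (1 : Matrix n n ℂ))).norm_det_le_exp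
  have hdet : (fromBlocks 1 U (-T) (1 : Matrix n n ℂ)).det = (1 + T * U).det := by
    rw [det_fromBlocks_one₁₁]; simp
  rw [det_mul, det_conjTranspose, norm_mul, norm_star, hdet, fromBlocks_conjTranspose,
    fromBlocks_multiply] at key
  have h0 := norm_pos_iff.2 h
  have := Real.log_le_log (by positivity) key
  rw [Real.log_mul h0.ne' h0.ne', Real.log_exp] at this
  simp [trace, Fintype.sum_sum_type, Finset.sum_add_distrib] at this
  simp only [logAbsDet, frobSq, trace, diag_apply, Complex.re_sum]
  linarith

theorem logAbsDet_one_add_mul_le_scaled (T U : Matrix n n ℂ) (h : (1 + T * U).det ≠ 0)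
    {c : ℝ} (hc : 0 < c) :
    logAbsDet (1 + T * U) ≤ (c * frobSq T + c⁻¹ * frobSq U) / 2 := by
  have hs := Real.sqrt_pos.2 hc
  have e : (√c • T) * ((√c)⁻¹ • U) = T * U := by
    rw [smul_mul_smul_comm, mul_inv_cancel₀ hs.ne', one_smul]
  have := logAbsDet_one_add_mul_le (√c • T) ((√c)⁻¹ • U) (by rwa [e])
  rwa [e, frobSq_smul, frobSq_smul, inv_pow, Real.sq_sqrt hc.le] at this

/-- The Cayley transform `(A - 1) (A + 1)⁻¹`. -/
noncomputable def cayley (A : Matrix n n ℂ) : Matrix n n ℂ := 1 - (2 : ℝ) • (A + 1)⁻¹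

theorem cayley_isHermitian {A : Matrix n n ℂ} (hA : A.PosDef) : (cayley A)ᴴ = cayley A := by
  have : ((A + 1)⁻¹)ᴴ = (A + 1)⁻¹ := (hA.add PosDef.one).inv.isHermitian
  simp [cayley, this]

theorem steinDiv_comm (A B : Matrix n n ℂ) : steinDiv A B = steinDiv B A := by
  simp [steinDiv, add_comm]

theorem det_half_smul_ne_zero {A : Matrix n n ℂ} (hA : A.det ≠ 0) :
    ((1 / 2 : ℝ) • A).det ≠ 0 := by
  rw [det_smul_of_tower]
  simpa using hA

theorem frobSq_cayley_le {A : Matrix n n ℂ} (hA : A.PosDef) :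
    frobSq (cayley A) ≤ 2 * steinDiv A 1 := by
  have hP := hA.add PosDef.one
  have hu : IsUnit (A + 1).det := isUnit_iff_ne_zero.2 hP.det_pos.ne'
  have hN : ((A + 1)⁻¹)ᴴ = (A + 1)⁻¹ := hP.inv.isHermitian
  set N := (A + 1)⁻¹ with hNdef
  have h1 : N * (A + 1) = 1 := nonsing_inv_mul _ hu
  have h2 : (A + 1) * N = 1 := mul_nonsing_inv _ hu
  have hNA : A * N = 1 - N := by rw [← h2]; noncomm_ring
  have e : 1 - cayley A * (cayley A)ᴴ = (4 : ℝ) • (Nᴴ * A * N) := by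
    rw [cayley_isHermitian hA, hN, mul_assoc, hNA, cayley, ← hNdef]
    have : (4 : ℝ) = 2 * 2 := by norm_num
    rw [this, mul_smul]
    simp only [two_smul]
    noncomm_ring
  have hPSD : ((4 : ℝ) • (Nᴴ * A * N)).PosSemidef :=
    (hA.posSemidef.conjTranspose_mul_mul_same N).smul (by norm_num)
  have key := hPSD.norm_det_le_exp
  have hAd := hA.det_pos.ne'
  have hPd := hP.det_pos.ne'
  have hNd : N.det ≠ 0 := hP.inv.det_pos.ne'
  have e2 : (4 : ℝ) • (Nᴴ * A * N) * (((1 / 2 : ℝ) • (A + 1)) * ((1 / 2 : ℝ) • (A + 1)))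
      = Nᴴ * A * (A + 1) := by
    simp only [smul_mul_assoc, mul_smul_comm, smul_smul]
    rw [mul_assoc (Nᴴ * A), ← mul_assoc N, h1, one_mul]
    norm_num
  have e3 : Nᴴ * A * (A + 1) = A := by
    rw [hN]
    have : A * (A + 1) = (A + 1) * A := by noncomm_ring
    rw [mul_assoc, this, ← mul_assoc, h1, one_mul]
  rw [e3] at e2
  have hQ : ((4 : ℝ) • (Nᴴ * A * N)).det ≠ 0 := by
    intro h0
    apply hAd
    rw [← e2, det_mul, h0, zero_mul]
  have hh := det_half_smul_ne_zero hPd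
  have l2 := congrArg logAbsDet e2
  rw [logAbsDet_mul hQ (by rw [det_mul]; exact mul_ne_zero hh hh), logAbsDet_mul hh hh] at l2
  have l1 := Real.log_le_log (norm_pos_iff.2 hQ) key
  rw [Real.log_exp, ← e] at l1
  rw [← e] at l2
  simp only [logAbsDet, frobSq, steinDiv, det_one, norm_one, Real.log_one] at *
  simp at l1
  linarith

theorem steinDiv_triangle_one {A C : Matrix n n ℂ} (hA : A.PosDef) (hC : C.PosDef)
    {c : ℝ} (hc : 0 < c) :
    steinDiv A C ≤ (1 + c) * steinDiv A 1 + (1 + c⁻¹) * steinDiv 1 C := by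
  have hP := hA.add PosDef.one
  have hQ := hC.add PosDef.one
  have hAC := det_half_smul_ne_zero (hA.add hC).det_pos.ne'
  have hP' := det_half_smul_ne_zero hP.det_pos.ne'
  have hQ' := det_half_smul_ne_zero hQ.det_pos.ne'
  have a2 : (A + 1) * (A + 1)⁻¹ = 1 := mul_nonsing_inv _ (isUnit_iff_ne_zero.2 hP.det_pos.ne')
  have c1 : (C + 1)⁻¹ * (C + 1) = 1 := nonsing_inv_mul _ (isUnit_iff_ne_zero.2 hQ.det_pos.ne')
  have ha : (A + 1) * cayley A = A - 1 := by
    rw [cayley, mul_sub, mul_smul_comm, a2, two_smul]; noncomm_ring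
  have hcc : cayley C * (C + 1) = C - 1 := by
    rw [cayley, sub_mul, smul_mul_assoc, c1, two_smul]; noncomm_ring
  have e : ((1 / 2 : ℝ) • (A + 1)) * (1 + cayley A * (-cayley C)) * ((1 / 2 : ℝ) • (C + 1))
      = (1 / 2 : ℝ) • (A + C) := by
    have : (A + 1) * (1 + cayley A * (-cayley C)) * (C + 1)
        = (A + 1) * (C + 1) - ((A + 1) * cayley A) * (cayley C * (C + 1)) := by noncomm_ring
    simp only [smul_mul_assoc, mul_smul_comm, smul_smul]
    rw [this, ha, hcc]
    have : (A + 1) * (C + 1) - (A - 1) * (C - 1) = (2 : ℝ) • (A + C) := by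
      rw [two_smul]; noncomm_ring
    rw [this, smul_smul]
    norm_num
  have hd : (1 + cayley A * (-cayley C)).det ≠ 0 := by
    intro h0
    apply hAC
    rw [← e, det_mul, det_mul, h0]; simp
  have l := congrArg logAbsDet e
  rw [logAbsDet_mul (by rw [det_mul]; exact mul_ne_zero hP' hd) hQ', logAbsDet_mul hP' hd] at l
  have b := logAbsDet_one_add_mul_le_scaled _ _ hd hc
  have f : frobSq (-cayley C) = frobSq (cayley C) := by simp [frobSq]
  have b1 := frobSq_cayley_le hA
  have b2 := frobSq_cayley_le hC
  rw [f] at b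
  have b3 := mul_le_mul_of_nonneg_left b1 hc.le
  have b4 := mul_le_mul_of_nonneg_left b2 (inv_pos.2 hc).le
  rw [steinDiv_comm 1 C]
  have x1 : steinDiv A C = steinDiv A 1 + steinDiv C 1 + logAbsDet (1 + cayley A * (-cayley C)) := by
    simp only [steinDiv, ← l, logAbsDet_one]; ring
  rw [x1]
  linarith

theorem steinDiv_congr {A C R : Matrix n n ℂ} (hA : A.PosDef) (hC : C.PosDef) (hR : R.det ≠ 0) :
    steinDiv (Rᴴ * A * R) (Rᴴ * C * R) = steinDiv A C := by
  have hR' : (Rᴴ).det ≠ 0 := by rw [det_conjTranspose]; exact star_ne_zero.2 hR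
  have h : ∀ M : Matrix n n ℂ, M.det ≠ 0 →
      logAbsDet (Rᴴ * M * R) = logAbsDet Rᴴ + logAbsDet M + logAbsDet R := fun M hM => by
    rw [logAbsDet_mul (by rw [det_mul]; exact mul_ne_zero hR' hM) hR, logAbsDet_mul hR' hM]
  have e : (1 / 2 : ℝ) • (Rᴴ * A * R + Rᴴ * C * R) = Rᴴ * ((1 / 2 : ℝ) • (A + C)) * R := by
    simp [mul_add, add_mul]
  simp only [steinDiv]
  rw [e, h _ (det_half_smul_ne_zero (hA.add hC).det_pos.ne'), h _ hA.det_pos.ne',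
    h _ hC.det_pos.ne']
  ring

open scoped MatrixOrder Matrix.Norms.L2Operator in
theorem Matrix.PosDef.exists_eq_conjTranspose_mul_self {B : Matrix n n ℂ} (hB : B.PosDef) :
    ∃ R : Matrix n n ℂ, R.det ≠ 0 ∧ B = Rᴴ * R := by
  obtain ⟨R, hR, h⟩ := CStarAlgebra.isStrictlyPositive_iff_eq_star_mul_self.mp
    (isStrictlyPositive_iff_posDef.2 hB)
  exact ⟨R, ((isUnit_iff_isUnit_det _).1 hR).ne_zero, h⟩

theorem Matrix.PosDef.exists_eq_conj {A R : Matrix n n ℂ} (hA : A.PosDef) (hR : R.det ≠ 0) :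
    ∃ A' : Matrix n n ℂ, A'.PosDef ∧ A = Rᴴ * A' * R := by
  have hu := isUnit_iff_ne_zero.2 hR
  refine ⟨(R⁻¹)ᴴ * A * R⁻¹, hA.conjTranspose_mul_mul_same (mulVec_injective_of_isUnit
    ((isUnit_iff_isUnit_det _).2 (isUnit_nonsing_inv_det _ hu))), ?_⟩
  have h1 : R⁻¹ * R = 1 := nonsing_inv_mul _ hu
  have h2 : Rᴴ * (R⁻¹)ᴴ = 1 := by rw [← conjTranspose_mul, h1, conjTranspose_one]
  calc A = (Rᴴ * (R⁻¹)ᴴ) * A * (R⁻¹ * R) := by rw [h1, h2]; simp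
    _ = _ := by noncomm_ring

theorem steinDiv_triangle {A B C : Matrix n n ℂ} (hA : A.PosDef) (hB : B.PosDef) (hC : C.PosDef)
    {c : ℝ} (hc : 0 < c) :
    steinDiv A C ≤ (1 + c) * steinDiv A B + (1 + c⁻¹) * steinDiv B C := by
  obtain ⟨R, hR, rfl⟩ := hB.exists_eq_conjTranspose_mul_self
  obtain ⟨A, hA', rfl⟩ := hA.exists_eq_conj hR
  obtain ⟨C, hC', rfl⟩ := hC.exists_eq_conj hR
  have e : Rᴴ * R = Rᴴ * 1 * R := by simp
  rw [e, steinDiv_congr hA' hC' hR, steinDiv_congr hA' .one hR, steinDiv_congr .one hC' hR]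
  exact steinDiv_triangle_one hA' hC' hc

theorem steinDiv_nonneg {A B : Matrix n n ℂ} (hA : A.PosDef) (hB : B.PosDef) :
    0 ≤ steinDiv A B := by
  obtain ⟨R, hR, rfl⟩ := hB.exists_eq_conjTranspose_mul_self
  obtain ⟨A, hA', rfl⟩ := hA.exists_eq_conj hR
  have e : Rᴴ * R = Rᴴ * 1 * R := by simp
  rw [e, steinDiv_congr hA' .one hR]
  linarith [frobSq_cayley_le hA', frobSq_nonneg (cayley A)]

theorem eq_of_steinDiv_eq_zero {A B : Matrix n n ℂ} (hA : A.PosDef) (hB : B.PosDef)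
    (h : steinDiv A B = 0) : A = B := by
  obtain ⟨R, hR, rfl⟩ := hB.exists_eq_conjTranspose_mul_self
  obtain ⟨A, hA', rfl⟩ := hA.exists_eq_conj hR
  have e : Rᴴ * R = Rᴴ * 1 * R := by simp
  rw [e, steinDiv_congr hA' .one hR] at h
  have hz : cayley A = 0 := frobSq_eq_zero
    (le_antisymm (by linarith [frobSq_cayley_le hA']) (frobSq_nonneg _))
  have hP := hA'.add PosDef.one
  have a2 : (A + 1) * (A + 1)⁻¹ = 1 := mul_nonsing_inv _ (isUnit_iff_ne_zero.2 hP.det_pos.ne')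
  have ha : (A + 1) * cayley A = A - 1 := by
    rw [cayley, mul_sub, mul_smul_comm, a2, two_smul]; noncomm_ring
  rw [hz, mul_zero] at ha
  rw [e, sub_eq_zero.1 ha.symm]

theorem logAbsDet_one_add_smul {X : Matrix n n ℂ} (hX : X.PosDef) {s : ℝ} (hs : 0 < s) :
    logAbsDet (1 + s • X) = ∑ i, Real.log (1 + hX.isHermitian.eigenvalues i * s) := by
  have hpos : ∀ i, 0 < 1 + hX.isHermitian.eigenvalues i * s := fun i => by
    have := hX.eigenvalues_pos i
    positivity
  set U := hX.isHermitian.eigenvectorUnitary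
  set l := hX.isHermitian.eigenvalues
  have hdet : (1 + s • X).det = ∏ i, ((1 + l i * s : ℝ) : ℂ) := by
    have hU : (U : Matrix n n ℂ) * star (U : Matrix n n ℂ) = 1 := Unitary.coe_mul_star_self U
    have hs' : 1 + s • X = (U : Matrix n n ℂ) *
        diagonal (fun i => ((1 + l i * s : ℝ) : ℂ)) * star (U : Matrix n n ℂ) := by
      have hd : diagonal (fun i => ((1 + l i * s : ℝ) : ℂ))
          = 1 + s • diagonal (RCLike.ofReal ∘ l : n → ℂ) := by
        rw [← diagonal_one, ← diagonal_smul, diagonal_add]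
        congr 1
        ext i
        simp [mul_comm]
      rw [hd, mul_add, add_mul, mul_one, hU, mul_smul_comm, smul_mul_assoc]
      congr 2
      exact hX.isHermitian.spectral_theorem
    rw [hs', det_mul, det_mul, mul_right_comm, ← det_mul, hU, det_one, one_mul, det_diagonal]
  rw [logAbsDet, hdet, norm_prod, Real.log_prod fun i _ => by
    simpa using Complex.ofReal_ne_zero.2 (hpos i).ne']
  refine Finset.sum_congr rfl fun i _ => ?_
  rw [Complex.norm_real, Real.norm_of_nonneg (hpos i).le]

theorem sum_powKernel_eigenvalues {X : Matrix n n ℂ} (hX : X.PosDef) (α : ℝ) {s : ℝ}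
    (hs : 0 < s) :
    ∑ i, powKernel α (hX.isHermitian.eigenvalues i) s
      = s ^ (-(α + 1)) * (X.trace.re * s - logAbsDet (1 + s • X)) := by
  rw [logAbsDet_one_add_smul hX hs, hX.isHermitian.trace_eq_sum_eigenvalues]
  simp [powKernel, ← Finset.mul_sum, Finset.sum_sub_distrib, Finset.sum_mul]

section traceF

variable {d : ℕ} {X Y : Matrix (Fin d) (Fin d) ℂ}

theorem traceF_id (hX : X.PosDef) : traceF (fun x => x) X = X.trace.re := by
  rw [traceF, dif_pos hX.isHermitian, hX.isHermitian.trace_eq_sum_eigenvalues]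
  simp

theorem integrableOn_sum_powKernel (hX : X.PosDef) {α : ℝ} (hα : α ∈ Ioo (1 : ℝ) 2) :
    IntegrableOn (fun s => ∑ i, powKernel α (hX.isHermitian.eigenvalues i) s) (Ioi 0) :=
  integrable_finsetSum _ fun i _ => integrableOn_powKernel hα (hX.eigenvalues_pos i).le

theorem integral_sum_powKernel (hX : X.PosDef) {α : ℝ} (hα : α ∈ Ioo (1 : ℝ) 2) :
    ∫ s in Ioi 0, ∑ i, powKernel α (hX.isHermitian.eigenvalues i) s
      = traceF (fun x => x ^ α) X * ∫ s in Ioi 0, powKernel α 1 s := by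
  rw [integral_finsetSum _ fun i _ => integrableOn_powKernel hα (hX.eigenvalues_pos i).le,
    traceF, dif_pos hX.isHermitian, Finset.sum_mul]
  exact Finset.sum_congr rfl fun i _ => integral_powKernel (hX.eigenvalues_pos i)

/-- The integrand representing `qjsdα` through Stein divergences. -/
noncomputable def qjsdIntegrand (α : ℝ) (X Y : Matrix (Fin d) (Fin d) ℂ) (s : ℝ) : ℝ :=
  s ^ (-(α + 1)) * steinDiv (1 + s • X) (1 + s • Y)

theorem posDef_midpoint (hX : X.PosDef) (hY : Y.PosDef) : ((1 / 2 : ℝ) • (X + Y)).PosDef :=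
  (hX.add hY).smul (by norm_num)

theorem trace_midpoint (X Y : Matrix (Fin d) (Fin d) ℂ) :
    ((1 / 2 : ℝ) • (X + Y)).trace.re = (1 / 2) * (X.trace.re + Y.trace.re) := by
  simp [mul_add]

theorem qjsdIntegrand_eq (hX : X.PosDef) (hY : Y.PosDef) (α : ℝ) {s : ℝ} (hs : 0 < s) :
    qjsdIntegrand α X Y s
      = (1 / 2) * (∑ i, powKernel α (hX.isHermitian.eigenvalues i) s
          + ∑ i, powKernel α (hY.isHermitian.eigenvalues i) s)
        - ∑ i, powKernel α ((posDef_midpoint hX hY).isHermitian.eigenvalues i) s := by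
  have e : (1 / 2 : ℝ) • (1 + s • X + (1 + s • Y)) = 1 + s • ((1 / 2 : ℝ) • (X + Y)) := by
    module
  rw [sum_powKernel_eigenvalues hX α hs, sum_powKernel_eigenvalues hY α hs,
    sum_powKernel_eigenvalues (posDef_midpoint hX hY) α hs, trace_midpoint, qjsdIntegrand,
    steinDiv, e]
  ring

theorem integrableOn_half_add_sum_powKernel (hX : X.PosDef) (hY : Y.PosDef) {α : ℝ}
    (hα : α ∈ Ioo (1 : ℝ) 2) :
    IntegrableOn (fun s => (1 / 2) * (∑ i, powKernel α (hX.isHermitian.eigenvalues i) s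
      + ∑ i, powKernel α (hY.isHermitian.eigenvalues i) s)) (Ioi 0) :=
  ((integrableOn_sum_powKernel hX hα).add (integrableOn_sum_powKernel hY hα)).const_mul (1 / 2)

theorem integrableOn_qjsdIntegrand (hX : X.PosDef) (hY : Y.PosDef) {α : ℝ}
    (hα : α ∈ Ioo (1 : ℝ) 2) : IntegrableOn (qjsdIntegrand α X Y) (Ioi 0) :=
  IntegrableOn.congr_fun ((integrableOn_half_add_sum_powKernel hX hY hα).sub
    (integrableOn_sum_powKernel (posDef_midpoint hX hY) hα))
    (fun _ hs => (qjsdIntegrand_eq hX hY α hs).symm) measurableSet_Ioi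

theorem integral_qjsdIntegrand (hX : X.PosDef) (hY : Y.PosDef) {α : ℝ}
    (hα : α ∈ Ioo (1 : ℝ) 2) :
    ∫ s in Ioi 0, qjsdIntegrand α X Y s
      = (α - 1) * (∫ s in Ioi 0, powKernel α 1 s) * qjsdα α X Y := by
  have hα' : 1 - α ≠ 0 := by linarith [hα.1]
  have iX := integrableOn_sum_powKernel hX hα
  have iY := integrableOn_sum_powKernel hY hα
  rw [setIntegral_congr_fun measurableSet_Ioi fun _ hs => qjsdIntegrand_eq hX hY α hs,
    integral_sub (integrableOn_half_add_sum_powKernel hX hY hα)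
      (integrableOn_sum_powKernel (posDef_midpoint hX hY) hα),
    integral_const_mul, integral_add iX iY, integral_sum_powKernel hX hα,
    integral_sum_powKernel hY hα, integral_sum_powKernel (posDef_midpoint hX hY) hα, qjsdα,
    tsallisEntropy, tsallisEntropy, tsallisEntropy, traceF_id hX, traceF_id hY,
    traceF_id (posDef_midpoint hX hY), trace_midpoint]
  field_simp
  ring

theorem qjsdIntegrand_nonneg (hX : X.PosDef) (hY : Y.PosDef) (α : ℝ) {s : ℝ} (hs : 0 < s) :
    0 ≤ qjsdIntegrand α X Y s :=
  mul_nonneg (Real.rpow_nonneg hs.le _)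
    (steinDiv_nonneg (hX.one_add_smul hs) (hY.one_add_smul hs))

theorem sub_one_mul_integral_powKernel_pos {α : ℝ} (hα : α ∈ Ioo (1 : ℝ) 2) :
    0 < (α - 1) * ∫ s in Ioi 0, powKernel α 1 s :=
  mul_pos (sub_pos.2 hα.1) (integral_powKernel_one_pos hα)

theorem qjsdα_nonneg (hX : X.PosDef) (hY : Y.PosDef) {α : ℝ} (hα : α ∈ Ioo (1 : ℝ) 2) :
    0 ≤ qjsdα α X Y := by
  have h := setIntegral_nonneg (μ := volume) measurableSet_Ioi
    fun s (hs : s ∈ Ioi (0 : ℝ)) => qjsdIntegrand_nonneg hX hY α hs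
  rw [integral_qjsdIntegrand hX hY hα] at h
  exact nonneg_of_mul_nonneg_right h (sub_one_mul_integral_powKernel_pos hα)

theorem qjsdα_self (α : ℝ) (X : Matrix (Fin d) (Fin d) ℂ) : qjsdα α X X = 0 := by
  have e : (1 / 2 : ℝ) • (X + X) = X := by module
  rw [qjsdα, e]
  ring

theorem qjsdα_comm (α : ℝ) (X Y : Matrix (Fin d) (Fin d) ℂ) : qjsdα α X Y = qjsdα α Y X := by
  rw [qjsdα, qjsdα, add_comm X, add_comm (tsallisEntropy α X)]

theorem eq_of_qjsdα_eq_zero (hX : X.PosDef) (hY : Y.PosDef) {α : ℝ} (hα : α ∈ Ioo (1 : ℝ) 2)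
    (h : qjsdα α X Y = 0) : X = Y := by
  have hi := integral_qjsdIntegrand hX hY hα
  rw [h, mul_zero] at hi
  obtain ⟨s, hs, h0⟩ := exists_eq_zero_of_setIntegral_Ioi_eq_zero
    (integrableOn_qjsdIntegrand hX hY hα) (fun s => qjsdIntegrand_nonneg hX hY α) hi
  have h1 := eq_of_steinDiv_eq_zero (hX.one_add_smul hs) (hY.one_add_smul hs)
    ((mul_eq_zero.1 h0).resolve_left (Real.rpow_pos_of_pos hs _).ne')
  exact smul_right_injective _ hs.ne' (add_left_cancel h1)

theorem qjsdα_le {Z : Matrix (Fin d) (Fin d) ℂ} (hX : X.PosDef) (hY : Y.PosDef) (hZ : Z.PosDef)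
    {α : ℝ} (hα : α ∈ Ioo (1 : ℝ) 2) {c : ℝ} (hc : 0 < c) :
    qjsdα α X Z ≤ (1 + c) * qjsdα α X Y + (1 + c⁻¹) * qjsdα α Y Z := by
  have iXY := (integrableOn_qjsdIntegrand hX hY hα).const_mul (1 + c)
  have iYZ := (integrableOn_qjsdIntegrand hY hZ hα).const_mul (1 + c⁻¹)
  have h := setIntegral_mono_on (integrableOn_qjsdIntegrand hX hZ hα) (iXY.add iYZ)
    measurableSet_Ioi fun s (hs : 0 < s) => by
      have := mul_le_mul_of_nonneg_left (steinDiv_triangle (hX.one_add_smul hs)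
        (hY.one_add_smul hs) (hZ.one_add_smul hs) hc) (Real.rpow_nonneg hs.le (-(α + 1)))
      calc _ ≤ _ := this
        _ = (1 + c) * qjsdIntegrand α X Y s + (1 + c⁻¹) * qjsdIntegrand α Y Z s := by
          simp only [qjsdIntegrand]; ring
  simp only [Pi.add_apply] at h
  rw [integral_add iXY iYZ, integral_const_mul, integral_const_mul,
    integral_qjsdIntegrand hX hZ hα, integral_qjsdIntegrand hX hY hα,
    integral_qjsdIntegrand hY hZ hα] at h
  refine le_of_mul_le_mul_left ?_ (sub_one_mul_integral_powKernel_pos hα)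
  linarith

end traceF

end

end

theorem sqrt_le_sqrt_add_sqrt_of_forall_le {p q r : ℝ} (hq : 0 < q) (hr : 0 < r)
    (h : ∀ c : ℝ, 0 < c → p ≤ (1 + c) * q + (1 + c⁻¹) * r) : √p ≤ √q + √r := by
  have hq' := Real.sqrt_pos.2 hq
  have hr' := Real.sqrt_pos.2 hr
  refine Real.sqrt_le_iff.2 ⟨by positivity, (h (√r / √q) (by positivity)).trans_eq ?_⟩
  conv_lhs => rw [← Real.sq_sqrt hq.le, ← Real.sq_sqrt hr.le]
  rw [Real.sqrt_sq hq'.le, Real.sqrt_sq hr'.le]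
  field_simp
  ring

/-- For `α ∈ (1,2)`, `√(QJSD_α)` is a metric on `ℙ_d`. -/
theorem qjsd_sqrt_metric_gt_one {d : ℕ} (α : ℝ) (hα : α ∈ Set.Ioo (1:ℝ) 2)
    (X Y Z : Matrix (Fin d) (Fin d) ℂ) (hX : X.PosDef) (hY : Y.PosDef) (hZ : Z.PosDef) :
    0 ≤ qjsdα α X Y ∧
    (qjsdα α X Y = 0 ↔ X = Y) ∧
    qjsdα α X Y = qjsdα α Y X ∧
    Real.sqrt (qjsdα α X Z) ≤ Real.sqrt (qjsdα α X Y) + Real.sqrt (qjsdα α Y Z) := by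
  refine ⟨qjsdα_nonneg hX hY hα, ⟨eq_of_qjsdα_eq_zero hX hY hα, ?_⟩, qjsdα_comm α X Y, ?_⟩
  · rintro rfl
    exact qjsdα_self α X
  · by_cases hXY : X = Y
    · subst hXY
      simp [qjsdα_self]
    by_cases hYZ : Y = Z
    · subst hYZ
      simp [qjsdα_self]
    exact sqrt_le_sqrt_add_sqrt_of_forall_le
      ((qjsdα_nonneg hX hY hα).lt_of_ne' (mt (eq_of_qjsdα_eq_zero hX hY hα) hXY))
      ((qjsdα_nonneg hY hZ hα).lt_of_ne' (mt (eq_of_qjsdα_eq_zero hY hZ hα) hYZ))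
      fun c hc => qjsdα_le hX hY hZ hα hc
end

section
/- The function √(QJSD) is a metric on ℙ_d: QJSD(X,Y) ≥ 0 with equality iff X = Y, QJSD(X,Y) = QJSD(Y,X), and √(QJSD(X,Z)) ≤ √(QJSD(X,Y)) + √(QJSD(Y,Z)) for all X, Y, Z ∈ ℙ_d. -/
open Matrix
open scoped ComplexOrder

/-- The von Neumann entropy `S(X) = −tr(X log X)`. -/
noncomputable def vnEntropy {d : ℕ} (X : Matrix (Fin d) (Fin d) ℂ) : ℝ :=
  -(traceF (fun x => x * Real.log x) X)

/-- The quantum Jensen-Shannon divergence `QJSD(X,Y) = S((X+Y)/2) − (1/2)(S(X)+S(Y))`. -/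
noncomputable def qjsd {d : ℕ} (X Y : Matrix (Fin d) (Fin d) ℂ) : ℝ :=
  vnEntropy ((1 / 2 : ℝ) • (X + Y)) - (1 / 2) * (vnEntropy X + vnEntropy Y)

theorem Real.sq_mul_log_cosh_le {u w : ℝ} (hu : 0 ≤ u) (huw : u ≤ w) :
    u ^ 2 * Real.log (Real.cosh w) ≤ w ^ 2 * Real.log (Real.cosh u) := by
  have hder : ∀ x : ℝ, HasDerivAt (fun x => Real.log (Real.cosh x))
      (Real.sinh x / Real.cosh x) x := fun x =>
    (Real.hasDerivAt_cosh x).log (Real.cosh_pos x).ne'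
  have hk : ∀ x : ℝ, 0 ≤ x →
      x * (Real.sinh x / Real.cosh x) ≤ 2 * Real.log (Real.cosh x) := by
    have hder2 : ∀ x : ℝ, HasDerivAt
        (fun x => 2 * Real.log (Real.cosh x) - x * (Real.sinh x / Real.cosh x))
        ((Real.sinh x * Real.cosh x - x) / Real.cosh x ^ 2) x := by
      intro x
      have hc := (Real.cosh_pos x).ne'
      refine (((hder x).const_mul 2).sub ((hasDerivAt_id x).mul
        ((Real.hasDerivAt_sinh x).div (Real.hasDerivAt_cosh x) hc))).congr_deriv ?_
      have := Real.cosh_sq x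
      simp only [id, Pi.div_apply]
      field_simp
      linear_combination x * (-this)
    have hmono : MonotoneOn
        (fun x => 2 * Real.log (Real.cosh x) - x * (Real.sinh x / Real.cosh x)) (Set.Ici 0) := by
      refine monotoneOn_of_deriv_nonneg (convex_Ici 0)
        (fun x _ => (hder2 x).continuousAt.continuousWithinAt)
        (fun x _ => (hder2 x).differentiableAt.differentiableWithinAt) fun x hx => ?_
      rw [interior_Ici, Set.mem_Ioi] at hx
      rw [(hder2 x).deriv]
      have h1 := Real.self_le_sinh_iff.2 hx.le
      have h2 := Real.one_le_cosh x
      apply div_nonneg _ (by positivity)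
      nlinarith
    intro x hx
    have := hmono Set.self_mem_Ici hx hx
    simp at this
    linarith
  rcases hu.eq_or_lt with rfl | hu
  · simp
  have hanti : AntitoneOn (fun x => Real.log (Real.cosh x) / x ^ 2) (Set.Ioi 0) := by
    have hder3 : ∀ x : ℝ, 0 < x → HasDerivAt (fun x => Real.log (Real.cosh x) / x ^ 2)
        ((x * (Real.sinh x / Real.cosh x) - 2 * Real.log (Real.cosh x)) / x ^ 3) x := by
      intro x hx
      refine ((hder x).div (hasDerivAt_pow 2 x) (by positivity)).congr_deriv ?_
      have hc := (Real.cosh_pos x).ne'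
      field_simp
      push_cast
      ring
    refine antitoneOn_of_deriv_nonpos (convex_Ioi 0)
        (fun x hx => (hder3 x hx).continuousAt.continuousWithinAt)
        (fun x hx => (hder3 x (interior_subset hx)).differentiableAt.differentiableWithinAt)
        fun x hx => ?_
    rw [interior_Ioi, Set.mem_Ioi] at hx
    rw [(hder3 x hx).deriv]
    exact div_nonpos_of_nonpos_of_nonneg (by linarith [hk x hx.le]) (by positivity)
  have hw := hu.trans_le huw
  have := hanti hu hw huw
  simp only at this
  rw [div_le_div_iff₀ (by positivity) (by positivity)] at this
  linarith

theorem Real.log_cosh_add_le (u v : ℝ) {r : ℝ} (hr : 0 < r) :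
    Real.log (Real.cosh (u + v)) ≤
      (1 + r) * Real.log (Real.cosh u) + (1 + r⁻¹) * Real.log (Real.cosh v) := by
  have hle : Real.log (Real.cosh (u + v)) ≤ Real.log (Real.cosh (|u| + |v|)) := by
    apply Real.log_le_log (Real.cosh_pos _)
    rw [Real.cosh_le_cosh]
    exact (abs_add_le u v).trans (le_abs_self _)
  refine hle.trans ?_
  rw [← Real.cosh_abs u, ← Real.cosh_abs v]
  have hu := abs_nonneg u
  have hv := abs_nonneg v
  generalize |u| = u at *
  generalize |v| = v at *
  have h1 := Real.sq_mul_log_cosh_le hu (le_add_of_nonneg_right hv : u ≤ u + v)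
  have h2 := Real.sq_mul_log_cosh_le hv (le_add_of_nonneg_left hu : v ≤ u + v)
  have h0 : 0 ≤ Real.log (Real.cosh (u + v)) := Real.log_nonneg (Real.one_le_cosh _)
  rcases (add_nonneg hu hv).eq_or_lt with h | h
  · obtain rfl : u = 0 := by linarith
    obtain rfl : v = 0 := by linarith
    simp
  have hkey : (u + v) ^ 2 ≤ (1 + r) * u ^ 2 + (1 + r⁻¹) * v ^ 2 := by
    have : (1 + r) * u ^ 2 + (1 + r⁻¹) * v ^ 2 - (u + v) ^ 2 = (r * u - v) ^ 2 / r := by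
      field_simp
      ring
    have : 0 ≤ (r * u - v) ^ 2 / r := by positivity
    linarith
  have h3 : (u + v) ^ 2 * Real.log (Real.cosh (u + v)) ≤ (u + v) ^ 2 *
      ((1 + r) * Real.log (Real.cosh u) + (1 + r⁻¹) * Real.log (Real.cosh v)) := by
    have h1' := mul_le_mul_of_nonneg_left h1 (by positivity : 0 ≤ 1 + r)
    have h2' := mul_le_mul_of_nonneg_left h2 (by positivity : 0 ≤ 1 + r⁻¹)
    have h4 := mul_le_mul_of_nonneg_right hkey h0
    linarith
  exact le_of_mul_le_mul_left h3 (by positivity)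

theorem Real.log_midpoint_sub_eq_log_cosh {x y : ℝ} (hx : 0 < x) (hy : 0 < y) :
    Real.log ((x + y) / 2) - Real.log x / 2 - Real.log y / 2 =
      Real.log (Real.cosh (Real.log x / 2 - Real.log y / 2)) := by
  have h : Real.cosh (Real.log x / 2 - Real.log y / 2) =
      (x + y) / 2 / (Real.exp (Real.log x / 2) * Real.exp (Real.log y / 2)) := by
    have hx' : x = Real.exp (Real.log x / 2) ^ 2 := by
      rw [← Real.exp_nat_mul]; push_cast; rw [mul_div_cancel₀ _ two_ne_zero, Real.exp_log hx]
    have hy' : y = Real.exp (Real.log y / 2) ^ 2 := by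
      rw [← Real.exp_nat_mul]; push_cast; rw [mul_div_cancel₀ _ two_ne_zero, Real.exp_log hy]
    rw [Real.cosh_eq, neg_sub, Real.exp_sub, Real.exp_sub]
    have h1 := (Real.exp_pos (Real.log x / 2)).ne'
    have h2 := (Real.exp_pos (Real.log y / 2)).ne'
    generalize Real.exp (Real.log x / 2) = p at *
    generalize Real.exp (Real.log y / 2) = q at *
    subst hx' hy'
    field_simp
  rw [h, Real.log_div (x := (x + y) / 2) (by positivity) (by positivity),
    Real.log_mul (by positivity) (by positivity),
    Real.log_exp, Real.log_exp]
  ring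

theorem Real.log_midpoint_sub_le {x y z : ℝ} (hx : 0 < x) (hy : 0 < y) (hz : 0 < z) {r : ℝ}
    (hr : 0 < r) :
    Real.log ((x + z) / 2) - Real.log x / 2 - Real.log z / 2 ≤
      (1 + r) * (Real.log ((x + y) / 2) - Real.log x / 2 - Real.log y / 2) +
      (1 + r⁻¹) * (Real.log ((y + z) / 2) - Real.log y / 2 - Real.log z / 2) := by
  rw [Real.log_midpoint_sub_eq_log_cosh hx hz, Real.log_midpoint_sub_eq_log_cosh hx hy,
    Real.log_midpoint_sub_eq_log_cosh hy hz]
  have := Real.log_cosh_add_le (Real.log x / 2 - Real.log y / 2)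
    (Real.log y / 2 - Real.log z / 2) hr
  rwa [sub_add_sub_cancel] at this

theorem Real.sqrt_le_sqrt_add_sqrt_of_forall {a b c : ℝ} (ha : 0 ≤ a) (hb : 0 ≤ b)
    (h : ∀ r : ℝ, 0 < r → c ≤ (1 + r) * a + (1 + r⁻¹) * b) :
    √c ≤ √a + √b := by
  have hε : ∀ ε : ℝ, 0 < ε → √c ≤ √a + √b + 2 * ε := by
    intro ε hε
    have hp : 0 < √a + ε := by positivity
    have hq : 0 < √b + ε := by positivity
    apply Real.sqrt_le_iff.2 ⟨by positivity, ?_⟩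
    have h1 := h ((√b + ε) / (√a + ε)) (by positivity)
    have ha' : a ≤ (√a + ε) ^ 2 := by nlinarith [Real.sq_sqrt ha, Real.sqrt_nonneg a]
    have hb' : b ≤ (√b + ε) ^ 2 := by nlinarith [Real.sq_sqrt hb, Real.sqrt_nonneg b]
    rw [show √a + √b + 2 * ε = (√a + ε) + (√b + ε) by ring]
    generalize √a + ε = p at *
    generalize √b + ε = q at *
    calc c ≤ (1 + q / p) * a + (1 + (q / p)⁻¹) * b := h1
      _ ≤ (1 + q / p) * p ^ 2 + (1 + (q / p)⁻¹) * q ^ 2 := by gcongr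
      _ = (p + q) ^ 2 := by field_simp; ring
  refine le_of_forall_pos_le_add fun ε h0 => ?_
  have := hε (ε / 2) (by positivity)
  linarith

open Finset in
theorem sum_sum_sum_mul_left {n : Type*} [Fintype n] [DecidableEq n] {α β : Matrix n n ℝ}
    (hα : α ∈ doublyStochastic ℝ n) (hβ : β ∈ doublyStochastic ℝ n) (f : n → ℝ) :
    ∑ k, ∑ i, ∑ j, α k i * β k j * f i = ∑ i, f i := by
  obtain ⟨-, -, hα⟩ := mem_doublyStochastic_iff_sum.1 hα
  obtain ⟨-, hβ, -⟩ := mem_doublyStochastic_iff_sum.1 hβ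
  have hj : ∀ k i, ∑ j, α k i * β k j * f i = α k i * f i := fun k i => by
    rw [← sum_mul, ← mul_sum, hβ, mul_one]
  simp only [hj]
  rw [sum_comm]
  exact sum_congr rfl fun i _ => by rw [← sum_mul, hα, one_mul]

open Finset in
theorem sum_sum_sum_mul_right {n : Type*} [Fintype n] [DecidableEq n] {α β : Matrix n n ℝ}
    (hα : α ∈ doublyStochastic ℝ n) (hβ : β ∈ doublyStochastic ℝ n) (f : n → ℝ) :
    ∑ k, ∑ i, ∑ j, α k i * β k j * f j = ∑ j, f j := by
  rw [← sum_sum_sum_mul_left hβ hα f]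
  refine sum_congr rfl fun k _ => ?_
  rw [sum_comm]
  simp_rw [mul_comm (α k _)]

open Finset in
theorem ConcaveOn.sum_mul_midpoint_le {n : Type*} [Fintype n] [DecidableEq n] {α β : Matrix n n ℝ}
    (hα : α ∈ doublyStochastic ℝ n) (hβ : β ∈ doublyStochastic ℝ n) {s : Set ℝ} {f : ℝ → ℝ}
    (hf : ConcaveOn ℝ s f) {a b : n → ℝ} (ha : ∀ i, a i ∈ s) (hb : ∀ i, b i ∈ s) {h : n → ℝ}
    (hh : ∀ k, h k = (∑ i, α k i * a i + ∑ j, β k j * b j) / 2) :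
    ∑ k, ∑ i, ∑ j, α k i * β k j * (f ((a i + b j) / 2) - f (a i) / 2 - f (b j) / 2) ≤
      ∑ k, f (h k) - (∑ i, f (a i)) / 2 - (∑ j, f (b j)) / 2 := by
  have h1 := sum_sum_sum_mul_left hα hβ fun i => f (a i) / 2
  have h2 := sum_sum_sum_mul_right hα hβ fun i => f (b i) / 2
  simp_rw [mul_sub, sum_sub_distrib]
  rw [h1, h2, sum_div, sum_div]
  gcongr with k
  obtain ⟨hα0, hα, -⟩ := mem_doublyStochastic_iff_sum.1 hα
  obtain ⟨hβ0, hβ, -⟩ := mem_doublyStochastic_iff_sum.1 hβ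
  have hJ := hf.le_map_sum (t := (univ : Finset (n × n))) (w := fun p => α k p.1 * β k p.2)
    (p := fun p => (a p.1 + b p.2) / 2) (fun p _ => mul_nonneg (hα0 _ _) (hβ0 _ _))
    (by simp_rw [Fintype.sum_prod_type, ← mul_sum, hβ, mul_one, hα])
    (fun p _ => by
      have := hf.1 (ha p.1) (hb p.2) (by norm_num : (0 : ℝ) ≤ 1 / 2)
        (by norm_num : (0 : ℝ) ≤ 1 / 2) (by norm_num)
      simp only [smul_eq_mul] at this
      convert this using 1
      ring)
  simp only [Fintype.sum_prod_type, smul_eq_mul] at hJ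
  convert hJ using 2
  have h3 : ∀ i j, α k i * β k j * ((a i + b j) / 2) =
      α k i * a i / 2 * β k j + α k i * (β k j * b j / 2) := fun i j => by ring
  simp_rw [h3, sum_add_distrib, ← mul_sum, hβ, ← sum_mul, hα, ← sum_div]
  rw [hh]
  ring

open Finset in
theorem Matrix.normSq_mem_doublyStochastic {n : Type*} [Fintype n] [DecidableEq n]
    (U : unitaryGroup n ℂ) :
    Matrix.of (fun i j => Complex.normSq (U.1 i j)) ∈ doublyStochastic ℝ n := by
  refine mem_doublyStochastic_iff_sum.2 ⟨fun i j => Complex.normSq_nonneg _, fun i => ?_,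
    fun j => ?_⟩
  · have h := congr_fun₂ (mem_unitaryGroup_iff.1 U.2) i i
    simp only [mul_apply, star_apply, one_apply_eq, RCLike.star_def, Complex.mul_conj] at h
    simp only [of_apply]
    exact_mod_cast h
  · have h := congr_fun₂ (mem_unitaryGroup_iff'.1 U.2) j j
    simp only [mul_apply, star_apply, one_apply_eq, RCLike.star_def,
      mul_comm ((starRingEnd ℂ) _), Complex.mul_conj] at h
    simp only [of_apply]
    exact_mod_cast h

open Finset in
/-- The eigenvalues of the midpoint of two Hermitian matrices are averages of their eigenvalues,
with doubly stochastic weights given by the squared overlaps of the eigenbases. -/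
theorem Matrix.IsHermitian.exists_doublyStochastic {n : Type*} [Fintype n] [DecidableEq n]
    {A B M : Matrix n n ℂ} (hA : A.IsHermitian) (hB : B.IsHermitian) (hM : M.IsHermitian)
    (h : M = (1 / 2 : ℝ) • (A + B)) :
    ∃ α ∈ doublyStochastic ℝ n, ∃ β ∈ doublyStochastic ℝ n,
      (∀ k, hM.eigenvalues k =
        (∑ i, α k i * hA.eigenvalues i + ∑ j, β k j * hB.eigenvalues j) / 2) ∧
      ((∀ k i j, α k i ≠ 0 → β k j ≠ 0 → hA.eigenvalues i = hB.eigenvalues j) → A = B) := by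
  set Q := hM.eigenvectorUnitary
  have hspec : ∀ {C : Matrix n n ℂ} (hC : C.IsHermitian) (k l : n),
      (star Q.1 * C * Q.1) k l = ∑ i, (star Q * hC.eigenvectorUnitary).1 k i *
        hC.eigenvalues i * star ((star Q * hC.eigenvectorUnitary).1 l i) := by
    intro C hC k l
    have : star Q.1 * C * Q.1 = (star Q * hC.eigenvectorUnitary).1 *
        diagonal (RCLike.ofReal ∘ hC.eigenvalues) * star (star Q * hC.eigenvectorUnitary).1 := by
      conv_lhs => rw [hC.spectral_theorem, Unitary.conjStarAlgAut_apply]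
      simp [mul_assoc]
    rw [this, mul_apply]
    simp [mul_diagonal]
  have hdiag : ∀ {C : Matrix n n ℂ} (hC : C.IsHermitian) (k : n),
      (star Q.1 * C * Q.1) k k = ((∑ i, Complex.normSq ((star Q * hC.eigenvectorUnitary).1 k i) *
        hC.eigenvalues i : ℝ) : ℂ) := by
    intro C hC k
    rw [hspec]
    push_cast
    simp_rw [← Complex.mul_conj, mul_right_comm _ (hC.eigenvalues _ : ℂ)]
    rfl
  refine ⟨_, normSq_mem_doublyStochastic (star Q * hA.eigenvectorUnitary), _,
    normSq_mem_doublyStochastic (star Q * hB.eigenvectorUnitary), fun k => ?_, fun H => ?_⟩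
  · have hk : (star Q.1 * M * Q.1) k k = (hM.eigenvalues k : ℂ) := by
      rw [hdiag hM]
      simp [Q, one_apply, apply_ite]
    have h2 : star Q.1 * M * Q.1 = (1 / 2 : ℝ) • (star Q.1 * A * Q.1 + star Q.1 * B * Q.1) := by
      rw [h]
      simp [mul_add, add_mul]
    rw [h2, smul_apply, add_apply, hdiag hA, hdiag hB] at hk
    simp only [of_apply]
    have hk' := congr_arg Complex.re hk
    simp only [Complex.smul_re, Complex.add_re, Complex.ofReal_re, smul_eq_mul] at hk'
    rw [← hk']
    ring
  · have hrow : ∀ {C : Matrix n n ℂ} (hC : C.IsHermitian) (k : n) (c : ℝ),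
        (∀ i, Complex.normSq ((star Q * hC.eigenvectorUnitary).1 k i) ≠ 0 →
          hC.eigenvalues i = c) → ∀ l, (star Q.1 * C * Q.1) k l = c * (1 : Matrix n n ℂ) k l := by
      intro C hC k c hc l
      rw [hspec hC, ← mem_unitaryGroup_iff.1 (star Q * hC.eigenvectorUnitary).2, mul_apply, mul_sum]
      refine sum_congr rfl fun i _ => ?_
      by_cases h0 : (star Q * hC.eigenvectorUnitary).1 k i = 0
      · simp [h0]
      · rw [hc i (by simpa using h0), star_apply]
        ring
    have hex : ∀ {C : Matrix n n ℂ} (hC : C.IsHermitian) (k : n),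
        ∃ i, Complex.normSq ((star Q * hC.eigenvectorUnitary).1 k i) ≠ 0 := by
      intro C hC k
      by_contra! h0
      have := (mem_doublyStochastic_iff_sum.1
        (normSq_mem_doublyStochastic (star Q * hC.eigenvectorUnitary))).2.1 k
      simp only [of_apply, h0] at this
      simp at this
    have heq : star Q.1 * A * Q.1 = star Q.1 * B * Q.1 := by
      ext k l
      obtain ⟨i, hi⟩ := hex hA k
      obtain ⟨j, hj⟩ := hex hB k
      rw [hrow hA k (hB.eigenvalues j) (fun i' hi' => H k i' j hi' hj),
        hrow hB k (hB.eigenvalues j) (fun j' hj' => (H k i j' hi hj').symm.trans (H k i j hi hj))]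
    have := congr_arg (fun R => Q.1 * R * star Q.1) heq
    simpa [mul_assoc, ← mul_assoc Q.1 (star Q.1)] using this

open Finset in
theorem Matrix.IsHermitian.det_smul_one_add_smul {n : Type*} [Fintype n] [DecidableEq n]
    {A : Matrix n n ℂ} (hA : A.IsHermitian) (a b : ℝ) :
    (a • (1 : Matrix n n ℂ) + b • A).det = ((∏ i, (a + b * hA.eigenvalues i) : ℝ) : ℂ) := by
  have h : a • (1 : Matrix n n ℂ) + b • A = hA.eigenvectorUnitary.1 *
      diagonal (fun i => ((a + b * hA.eigenvalues i : ℝ) : ℂ)) *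
        star hA.eigenvectorUnitary.1 := by
    have h1 : diagonal (fun i => ((a + b * hA.eigenvalues i : ℝ) : ℂ)) =
        a • (1 : Matrix n n ℂ) + b • diagonal (RCLike.ofReal ∘ hA.eigenvalues) := by
      ext i j
      by_cases hij : i = j
      · subst hij
        simp
      · simp [hij]
    rw [h1]
    conv_lhs => rw [hA.spectral_theorem, Unitary.conjStarAlgAut_apply]
    simp [mul_add, add_mul]
  rw [h, det_mul_right_comm, mem_unitaryGroup_iff.1 hA.eigenvectorUnitary.2, one_mul, det_diagonal]
  push_cast
  rfl

/-- The symmetric Stein divergence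
`log det ((A + B) / 2) - (log det A) / 2 - (log det B) / 2`. -/
noncomputable def logDetDiv {n : Type*} [Fintype n] [DecidableEq n] (A B : Matrix n n ℂ) : ℝ :=
  Real.log ((1 / 2 : ℝ) • (A + B)).det.re - Real.log A.det.re / 2 - Real.log B.det.re / 2

theorem Matrix.PosDef.midpoint {n : Type*} {A B : Matrix n n ℂ} (hA : A.PosDef) (hB : B.PosDef) :
    ((1 / 2 : ℝ) • (A + B)).PosDef :=
  (hA.add hB).smul (by norm_num)

open Finset in
theorem Matrix.PosDef.log_det_smul_one_add_smul {n : Type*} [Fintype n] [DecidableEq n]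
    {A : Matrix n n ℂ} (hA : A.PosDef) {a b : ℝ} (ha : 0 ≤ a) (hb : 0 < b) :
    Real.log (a • (1 : Matrix n n ℂ) + b • A).det.re =
      ∑ i, Real.log (a + b * hA.isHermitian.eigenvalues i) := by
  rw [hA.isHermitian.det_smul_one_add_smul, Complex.ofReal_re, Real.log_prod]
  intro i _
  have := hA.eigenvalues_pos i
  positivity

theorem Matrix.PosDef.log_det {n : Type*} [Fintype n] [DecidableEq n]
    {A : Matrix n n ℂ} (hA : A.PosDef) :
    Real.log A.det.re = ∑ i, Real.log (hA.isHermitian.eigenvalues i) := by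
  simpa using hA.log_det_smul_one_add_smul le_rfl one_pos

theorem logDetDiv_conj {n : Type*} [Fintype n] [DecidableEq n] {A B S : Matrix n n ℂ}
    (hA : A.PosDef) (hB : B.PosDef) (hS : S.det ≠ 0) :
    logDetDiv (S * A * star S) (S * B * star S) = logDetDiv A B := by
  have h : ∀ C : Matrix n n ℂ, C.PosDef → Real.log (S * C * star S).det.re =
      Real.log (Complex.normSq S.det) + Real.log C.det.re := by
    intro C hC
    rw [← Real.log_mul (by simpa using hS) (Complex.pos_iff.1 hC.det_pos).1.ne', det_mul, det_mul,
      star_eq_conjTranspose, det_conjTranspose, mul_right_comm, RCLike.star_def, Complex.mul_conj,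
      Complex.re_ofReal_mul]
  have hmid : (1 / 2 : ℝ) • (S * A * star S + S * B * star S) =
      S * ((1 / 2 : ℝ) • (A + B)) * star S := by
    simp [mul_add, add_mul]
  rw [logDetDiv, hmid, h A hA, h B hB, h _ (hA.midpoint hB), logDetDiv]
  ring

theorem Matrix.PosDef.exists_conj_eq_one {n : Type*} [Fintype n] [DecidableEq n]
    {A : Matrix n n ℂ} (hA : A.PosDef) :
    ∃ S : Matrix n n ℂ, S.det ≠ 0 ∧ S * A * star S = 1 := by
  set U := hA.isHermitian.eigenvectorUnitary
  set D : Matrix n n ℂ :=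
    diagonal fun i => (((√(hA.isHermitian.eigenvalues i))⁻¹ : ℝ) : ℂ)
  have hS : D * star U.1 * A * star (D * star U.1) = 1 := by
    have hD : star D = D := by
      ext i j
      by_cases hij : i = j
      · subst hij
        simp [D]
      · simp [D, hij, Ne.symm hij]
    have h1 : D * star U.1 * A * star (D * star U.1) =
        D * diagonal (RCLike.ofReal ∘ hA.isHermitian.eigenvalues) * D := by
      conv_lhs => rw [hA.isHermitian.spectral_theorem, Unitary.conjStarAlgAut_apply]
      rw [star_mul, star_star, hD]
      calc _ = D * (star U.1 * U.1) * diagonal (RCLike.ofReal ∘ hA.isHermitian.eigenvalues) *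
              (star U.1 * U.1) * D := by simp only [mul_assoc]; rfl
        _ = _ := by rw [mem_unitaryGroup_iff'.1 U.2, mul_one, mul_one]
    rw [h1, diagonal_mul_diagonal, diagonal_mul_diagonal, diagonal_eq_one]
    ext i
    have hi := hA.eigenvalues_pos i
    have hs := Real.mul_self_sqrt hi.le
    have hp := (Real.sqrt_pos.2 hi).ne'
    have : (√(hA.isHermitian.eigenvalues i))⁻¹ * hA.isHermitian.eigenvalues i *
        (√(hA.isHermitian.eigenvalues i))⁻¹ = 1 := by
      field_simp
      rw [sq, hs]
    change Complex.ofReal _ * Complex.ofReal _ * Complex.ofReal _ = 1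
    exact_mod_cast this
  refine ⟨D * star U.1, fun h0 => ?_, hS⟩
  have := congr_arg det hS
  rw [det_mul, det_mul, h0] at this
  simp at this

open Finset in
theorem logDetDiv_one_le {n : Type*} [Fintype n] [DecidableEq n] {B C : Matrix n n ℂ}
    (hB : B.PosDef) (hC : C.PosDef) {r : ℝ} (hr : 0 < r) :
    logDetDiv 1 C ≤ (1 + r) * logDetDiv 1 B + (1 + r⁻¹) * logDetDiv B C := by
  have hone : ∀ {A : Matrix n n ℂ} (hA : A.PosDef), logDetDiv 1 A =
      ∑ i, (Real.log ((1 + hA.isHermitian.eigenvalues i) / 2) - Real.log 1 / 2 -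
        Real.log (hA.isHermitian.eigenvalues i) / 2) := by
    intro A hA
    rw [logDetDiv, hA.log_det, smul_add, hA.log_det_smul_one_add_smul (by norm_num) (by norm_num)]
    simp only [sum_sub_distrib, ← sum_div, det_one, Complex.one_re, Real.log_one, zero_div, sub_zero]
    congr 1
    refine sum_congr rfl fun i _ => ?_
    congr 1
    ring
  obtain ⟨α, hα, β, hβ, hh, -⟩ := hB.isHermitian.exists_doublyStochastic hC.isHermitian
    (hB.midpoint hC).isHermitian rfl
  have hα0 := (mem_doublyStochastic_iff_sum.1 hα).1
  have hβ0 := (mem_doublyStochastic_iff_sum.1 hβ).1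
  have hJ := strictConcaveOn_log_Ioi.concaveOn.sum_mul_midpoint_le hα hβ hB.eigenvalues_pos
    hC.eigenvalues_pos hh
  have hBC : logDetDiv B C = ∑ k, Real.log ((hB.midpoint hC).isHermitian.eigenvalues k) -
      (∑ i, Real.log (hB.isHermitian.eigenvalues i)) / 2 -
      (∑ j, Real.log (hC.isHermitian.eigenvalues j)) / 2 := by
    rw [logDetDiv, hB.log_det, hC.log_det, (hB.midpoint hC).log_det]
  rw [← hBC] at hJ
  refine le_trans ?_ (add_le_add_right (mul_le_mul_of_nonneg_left hJ
    (by positivity : 0 ≤ 1 + r⁻¹)) _)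
  have hB' := sum_sum_sum_mul_left hα hβ fun i =>
    Real.log ((1 + hB.isHermitian.eigenvalues i) / 2) - Real.log 1 / 2 -
      Real.log (hB.isHermitian.eigenvalues i) / 2
  have hC' := sum_sum_sum_mul_right hα hβ fun i =>
    Real.log ((1 + hC.isHermitian.eigenvalues i) / 2) - Real.log 1 / 2 -
      Real.log (hC.isHermitian.eigenvalues i) / 2
  rw [hone hB, hone hC, ← hB', ← hC']
  simp only [mul_sum, ← sum_add_distrib]
  gcongr with k _ i _ j _
  have h := mul_le_mul_of_nonneg_left (Real.log_midpoint_sub_le one_pos (hB.eigenvalues_pos i)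
    (hC.eigenvalues_pos j) hr) (mul_nonneg (hα0 k i) (hβ0 k j))
  linarith

theorem logDetDiv_le {n : Type*} [Fintype n] [DecidableEq n] {A B C : Matrix n n ℂ}
    (hA : A.PosDef) (hB : B.PosDef) (hC : C.PosDef) {r : ℝ} (hr : 0 < r) :
    logDetDiv A C ≤ (1 + r) * logDetDiv A B + (1 + r⁻¹) * logDetDiv B C := by
  obtain ⟨S, hS, hSA⟩ := hA.exists_conj_eq_one
  have hconj : ∀ {D : Matrix n n ℂ}, D.PosDef → (S * D * star S).PosDef := fun hD =>
    hD.mul_mul_conjTranspose_same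
      (Matrix.vecMul_injective_of_isUnit ((isUnit_iff_isUnit_det S).2 hS.isUnit))
  rw [← logDetDiv_conj hA hC hS, ← logDetDiv_conj hA hB hS, ← logDetDiv_conj hB hC hS, hSA]
  exact logDetDiv_one_le (hconj hB) (hconj hC) hr

open Finset Filter Topology in
theorem tendsto_sum_add_mul_log {n : Type*} [Fintype n] (x : n → ℝ) :
    Tendsto (fun t => ∑ i, (t + x i) * Real.log (t + x i) -
      (Fintype.card n * t + ∑ i, x i) * Real.log t) atTop (𝓝 (∑ i, x i)) := by
  have h : ∀ i, Tendsto (fun t => t * Real.log (1 + x i / t) + x i * Real.log (1 + x i / t)) atTop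
      (𝓝 (x i)) := by
    intro i
    have h1 : Tendsto (fun t => Real.log (1 + x i / t)) atTop (𝓝 0) := by
      have : Tendsto (fun t => 1 + x i / t) atTop (𝓝 1) := by
        simpa using (tendsto_const_nhds (x := x i)).div_atTop tendsto_id |>.const_add 1
      simpa using this.log one_ne_zero
    simpa using (Real.tendsto_mul_log_one_add_div_atTop (x i)).add (h1.const_mul (x i))
  refine (tendsto_finsetSum univ fun i _ => h i).congr' ?_
  have hpos : ∀ᶠ t : ℝ in atTop, ∀ i, 0 < t + x i := by
    rw [eventually_all]
    intro i
    filter_upwards [eventually_gt_atTop (-x i)] with t ht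
    linarith
  filter_upwards [hpos, eventually_gt_atTop 0] with t ht ht0
  have : (Fintype.card n * t + ∑ i, x i) * Real.log t = ∑ i, (t + x i) * Real.log t := by
    rw [← sum_mul, sum_add_distrib]
    simp
  rw [this, ← sum_sub_distrib]
  refine sum_congr rfl fun i _ => ?_
  rw [show 1 + x i / t = (t + x i) / t by field_simp, Real.log_div (ht i).ne' ht0.ne']
  ring

theorem hasDerivAt_sum_add_mul_log {n : Type*} [Fintype n] {x : n → ℝ} (hx : ∀ i, 0 < x i) {t : ℝ}
    (ht : 0 ≤ t) :
    HasDerivAt (fun t => ∑ i, (t + x i) * Real.log (t + x i))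
      (∑ i, Real.log (t + x i) + Fintype.card n) t := by
  have h : ∀ i ∈ Finset.univ, HasDerivAt (fun t => (t + x i) * Real.log (t + x i))
      (Real.log (t + x i) + 1) t := fun i _ =>
    (Real.hasDerivAt_mul_log (add_pos_of_nonneg_of_pos ht (hx i)).ne').comp_add_const t (x i)
  refine (HasDerivAt.fun_sum h).congr_deriv ?_
  simp [Finset.sum_add_distrib]

theorem vnEntropy_eq_sum_negMulLog {d : ℕ} {X : Matrix (Fin d) (Fin d) ℂ} (hX : X.IsHermitian) :
    vnEntropy X = ∑ i, Real.negMulLog (hX.eigenvalues i) := by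
  simp [vnEntropy, traceF, hX, Real.negMulLog, Finset.sum_neg_distrib]

open Filter Topology in
/-- A primitive of `t ↦ -logDetDiv (t + X) (t + Y)`, equal to `qjsd X Y` at `0` and vanishing at
infinity. -/
theorem exists_primitive_logDetDiv {d : ℕ} {X Y : Matrix (Fin d) (Fin d) ℂ} (hX : X.PosDef)
    (hY : Y.PosDef) :
    ∃ G : ℝ → ℝ, G 0 = qjsd X Y ∧ Tendsto G atTop (𝓝 0) ∧
      ∀ t : ℝ, 0 ≤ t → HasDerivAt G (-logDetDiv (t • 1 + X) (t • 1 + Y)) t := by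
  have hM := hX.midpoint hY
  let K : (Fin d → ℝ) → ℝ → ℝ := fun x t => ∑ i, (t + x i) * Real.log (t + x i)
  set x := hX.isHermitian.eigenvalues with hx
  set y := hY.isHermitian.eigenvalues with hy
  set m := hM.isHermitian.eigenvalues with hm
  refine ⟨fun t => K x t / 2 + K y t / 2 - K m t, ?_, ?_, fun t ht => ?_⟩
  · simp only [qjsd, vnEntropy_eq_sum_negMulLog hX.isHermitian,
      vnEntropy_eq_sum_negMulLog hY.isHermitian, vnEntropy_eq_sum_negMulLog hM.isHermitian,
      Real.negMulLog, K, zero_add, neg_mul, Finset.sum_neg_distrib, ← hx, ← hy, ← hm]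
    ring
  · have htr : ∑ i, m i = (∑ i, x i + ∑ i, y i) / 2 := by
      have htrace : ∀ {A : Matrix (Fin d) (Fin d) ℂ} (hA : A.IsHermitian),
          ∑ i, hA.eigenvalues i = A.trace.re := fun hA => by
        rw [hA.trace_eq_sum_eigenvalues]
        simp
      rw [hx, hy, hm, htrace, htrace, htrace, trace_smul, trace_add, Complex.smul_re,
        Complex.add_re, smul_eq_mul]
      ring
    have := (((tendsto_sum_add_mul_log x).div_const 2).add
      ((tendsto_sum_add_mul_log y).div_const 2)).sub (tendsto_sum_add_mul_log m)
    rw [htr, show (∑ i, x i) / 2 + (∑ i, y i) / 2 - (∑ i, x i + ∑ i, y i) / 2 = 0 by ring] at this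
    refine this.congr fun t => ?_
    simp only [K]
    ring
  · have h := (((hasDerivAt_sum_add_mul_log hX.eigenvalues_pos ht).div_const 2).add
      ((hasDerivAt_sum_add_mul_log hY.eigenvalues_pos ht).div_const 2)).sub
      (hasDerivAt_sum_add_mul_log hM.eigenvalues_pos ht)
    refine h.congr_deriv ?_
    have hmid : (1 / 2 : ℝ) • (t • 1 + X + (t • 1 + Y)) = t • 1 + (1 / 2 : ℝ) • (X + Y) := by
      module
    have hlog : ∀ {A : Matrix (Fin d) (Fin d) ℂ} (hA : A.PosDef), Real.log (t • 1 + A).det.re =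
        ∑ i, Real.log (t + hA.isHermitian.eigenvalues i) := fun hA => by
      simpa using hA.log_det_smul_one_add_smul ht one_pos
    rw [logDetDiv, hmid, hlog hX, hlog hY, hlog hM]
    ring

open Filter Topology in
theorem qjsd_le {d : ℕ} {X Y Z : Matrix (Fin d) (Fin d) ℂ} (hX : X.PosDef) (hY : Y.PosDef)
    (hZ : Z.PosDef) {r : ℝ} (hr : 0 < r) :
    qjsd X Z ≤ (1 + r) * qjsd X Y + (1 + r⁻¹) * qjsd Y Z := by
  obtain ⟨F, hF0, hF, hF'⟩ := exists_primitive_logDetDiv hX hY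
  obtain ⟨G, hG0, hG, hG'⟩ := exists_primitive_logDetDiv hY hZ
  obtain ⟨H, hH0, hH, hH'⟩ := exists_primitive_logDetDiv hX hZ
  have hlim := ((hF.const_mul (1 + r)).add (hG.const_mul (1 + r⁻¹))).sub hH
  have hder := fun t ht => (((hF' t ht).const_mul (1 + r)).add
    ((hG' t ht).const_mul (1 + r⁻¹))).sub (hH' t ht)
  have hanti := antitoneOn_of_deriv_nonpos (convex_Ici (0 : ℝ))
    (fun t ht => (hder t ht).continuousAt.continuousWithinAt)
    (fun t ht => (hder t (interior_subset ht)).differentiableAt.differentiableWithinAt)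
    (fun t ht => by
      have ht' : 0 ≤ t := interior_subset ht
      have hshift : ∀ {A : Matrix (Fin d) (Fin d) ℂ}, A.PosDef → (t • 1 + A).PosDef := fun hA =>
        hA.posSemidef_add (PosSemidef.one.smul ht')
      rw [(hder t ht').deriv]
      linarith [logDetDiv_le (hshift hX) (hshift hY) (hshift hZ) hr])
  have h0 := le_of_tendsto hlim (b := (1 + r) * F 0 + (1 + r⁻¹) * G 0 - H 0) (by
    filter_upwards [eventually_ge_atTop 0] with t ht
    exact hanti Set.self_mem_Ici ht ht)
  rw [hF0, hG0, hH0] at h0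
  linarith

theorem qjsd_comm {d : ℕ} (X Y : Matrix (Fin d) (Fin d) ℂ) : qjsd X Y = qjsd Y X := by
  rw [qjsd, qjsd, add_comm X, add_comm (vnEntropy X)]

theorem qjsd_self {d : ℕ} (X : Matrix (Fin d) (Fin d) ℂ) : qjsd X X = 0 := by
  have : (1 / 2 : ℝ) • (X + X) = X := by module
  rw [qjsd, this]
  ring

theorem Real.negMulLog_midpoint_sub_nonneg {x y : ℝ} (hx : 0 ≤ x) (hy : 0 ≤ y) :
    0 ≤ Real.negMulLog ((x + y) / 2) - Real.negMulLog x / 2 - Real.negMulLog y / 2 := by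
  have h := Real.concaveOn_negMulLog.2 hx hy (by norm_num : (0 : ℝ) ≤ 1 / 2)
    (by norm_num : (0 : ℝ) ≤ 1 / 2) (by norm_num)
  simp only [smul_eq_mul] at h
  rw [show 1 / 2 * x + 1 / 2 * y = (x + y) / 2 by ring] at h
  linarith

theorem Real.eq_of_negMulLog_midpoint_sub_eq_zero {x y : ℝ} (hx : 0 ≤ x) (hy : 0 ≤ y)
    (h0 : Real.negMulLog ((x + y) / 2) - Real.negMulLog x / 2 - Real.negMulLog y / 2 = 0) :
    x = y := by
  by_contra hne
  have h := Real.strictConcaveOn_negMulLog.2 hx hy hne (by norm_num : (0 : ℝ) < 1 / 2)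
    (by norm_num : (0 : ℝ) < 1 / 2) (by norm_num)
  simp only [smul_eq_mul] at h
  rw [show 1 / 2 * x + 1 / 2 * y = (x + y) / 2 by ring] at h
  linarith

open Finset in
theorem qjsd_nonneg_and_eq_of_eq_zero {d : ℕ} {X Y : Matrix (Fin d) (Fin d) ℂ} (hX : X.PosDef)
    (hY : Y.PosDef) : 0 ≤ qjsd X Y ∧ (qjsd X Y = 0 → X = Y) := by
  have hM := hX.midpoint hY
  obtain ⟨α, hα, β, hβ, hh, heq⟩ := hX.isHermitian.exists_doublyStochastic hY.isHermitian
    hM.isHermitian rfl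
  have hα0 := (mem_doublyStochastic_iff_sum.1 hα).1
  have hβ0 := (mem_doublyStochastic_iff_sum.1 hβ).1
  have hx := fun i => (hX.eigenvalues_pos i).le
  have hy := fun i => (hY.eigenvalues_pos i).le
  have hJ := Real.concaveOn_negMulLog.sum_mul_midpoint_le hα hβ hx hy hh
  rw [← vnEntropy_eq_sum_negMulLog, ← vnEntropy_eq_sum_negMulLog, ← vnEntropy_eq_sum_negMulLog,
    show vnEntropy ((1 / 2 : ℝ) • (X + Y)) - vnEntropy X / 2 - vnEntropy Y / 2 = qjsd X Y by
      rw [qjsd]; ring] at hJ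
  have hterm := fun k i j => mul_nonneg (mul_nonneg (hα0 k i) (hβ0 k j))
    (Real.negMulLog_midpoint_sub_nonneg (hx i) (hy j))
  have hj := fun k i => sum_nonneg fun j (_ : j ∈ univ) => hterm k i j
  have hi := fun k => sum_nonneg fun i (_ : i ∈ univ) => hj k i
  have hk := sum_nonneg fun k (_ : k ∈ univ) => hi k
  refine ⟨hk.trans hJ, fun h0 => heq fun k i j hki hkj => ?_⟩
  have h1 := (sum_eq_zero_iff_of_nonneg fun k _ => hi k).1 (le_antisymm (h0 ▸ hJ) hk) k (mem_univ _)
  have h2 := (sum_eq_zero_iff_of_nonneg fun i _ => hj k i).1 h1 i (mem_univ _)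
  have h3 := (sum_eq_zero_iff_of_nonneg fun j _ => hterm k i j).1 h2 j (mem_univ _)
  exact Real.eq_of_negMulLog_midpoint_sub_eq_zero (hx i) (hy j)
    ((mul_eq_zero.1 h3).resolve_left (mul_ne_zero hki hkj))

/-- **Conjecture of Lamberti et al.**: `√QJSD` is a metric on `ℙ_d`. -/
theorem qjsd_sqrt_metric {d : ℕ}
    (X Y Z : Matrix (Fin d) (Fin d) ℂ) (hX : X.PosDef) (hY : Y.PosDef) (hZ : Z.PosDef) :
    0 ≤ qjsd X Y ∧
    (qjsd X Y = 0 ↔ X = Y) ∧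
    qjsd X Y = qjsd Y X ∧
    Real.sqrt (qjsd X Z) ≤ Real.sqrt (qjsd X Y) + Real.sqrt (qjsd Y Z) := by
  obtain ⟨hXY, hXY0⟩ := qjsd_nonneg_and_eq_of_eq_zero hX hY
  obtain ⟨hYZ, -⟩ := qjsd_nonneg_and_eq_of_eq_zero hY hZ
  refine ⟨hXY, ⟨hXY0, ?_⟩, qjsd_comm X Y,
    Real.sqrt_le_sqrt_add_sqrt_of_forall hXY hYZ fun r hr => qjsd_le hX hY hZ hr⟩
  rintro rfl
  exact qjsd_self X
end
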